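/- Given real intervals [t₀,t₁] and [c,d] with t₀ < t₁ and c < d, there exist a continuous map γ : [t₀,t₁] → 𝕋 × [c,d], a map t ∈ [t₀,t₁] ↦ F_t ∈ C^∞(𝕋) continuous into the C^∞ topology, and a continuous function ψ : 𝕋 × [c,d] → ℝ, such that: (i) F_{t₀} ≡ c and F_{t₁} ≡ d; (ii) if t ≤ s then F_t ≤ F_s pointwise; (iii) writing γ(t) = (x(t), y(t)), one has y(t) = F_t(x(t)); (iv) F_t′(x) = ψ(x, F_t(x)) for all t and all x ∈ 𝕋; (v) for each t ∈ (t₀,t₁], the image γ([t₀,t]) equals the closure of the interior of {(x,y) : x ∈ 𝕋, c ≤ y ≤ F_t(x)} in 𝕋 × [c,d] viewed as a subset of 𝕋 × ℝ; (vi) γ(t₀) = (0, c) and γ(t₁) = (π, d), where 0 and π denote the corresponding points of 𝕋 = ℝ/2πℤ. -/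

import Mathlib

open Set

/-- The circle `𝕋 = ℝ/2πℤ`. -/
abbrev RealTorus : Type := AddCircle (2 * Real.pi)

/-- The distance to the nearest integer. -/
noncomputable def triWave (s : ℝ) : ℝ := ‖(s : UnitAddCircle)‖

lemma triWave_sub_le (s t : ℝ) : |triWave s - triWave t| ≤ |s - t| := by
  unfold triWave
  refine (abs_norm_sub_norm_le _ _).trans ?_
  rw [← AddCircle.coe_sub, UnitAddCircle.norm_eq]
  simpa using round_le (s - t) 0

lemma continuous_triWave : Continuous triWave :=
  continuous_norm.comp (AddCircle.continuous_mk' (1 : ℝ))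

lemma triWave_periodic : Function.Periodic triWave 1 := fun s => by
  unfold triWave
  rw [AddCircle.coe_add_period]

lemma triWave_nat (n : ℕ) : triWave n = 0 := by
  have := triWave_periodic.nat_mul n 0
  simp only [mul_one, zero_add] at this
  rw [this]
  simp [triWave]

lemma triWave_nonneg (s : ℝ) : 0 ≤ triWave s := norm_nonneg _

lemma triWave_le_one (s : ℝ) : triWave s ≤ 1 := by
  unfold triWave
  rw [UnitAddCircle.norm_eq]
  exact (abs_sub_round s).trans (by norm_num)

lemma triWave_eq_abs {s : ℝ} (hs : |s| ≤ 1 / 2) : triWave s = |s| :=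
  (AddCircle.norm_coe_eq_abs_iff 1 one_ne_zero).2 (by simpa using hs)

lemma norm_cexp_I_mul_mul (u x : ℝ) : ‖Complex.exp (Complex.I * u * x)‖ = 1 := by
  rw [show Complex.I * (u : ℂ) * x = ((u * x : ℝ) : ℂ) * Complex.I by push_cast; ring]
  exact Complex.norm_exp_ofReal_mul_I _

lemma norm_integral_cexp_le {a b u : ℝ} (hu : u ≠ 0) :
    ‖∫ v in a..b, Complex.exp (Complex.I * u * v)‖ ≤ 2 / |u| := by
  have h0 : Complex.I * (u : ℂ) ≠ 0 := by simp [hu]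
  rw [integral_exp_mul_complex h0, norm_div]
  have : ‖Complex.I * (u : ℂ)‖ = |u| := by simp
  rw [this]
  gcongr
  refine (norm_sub_le _ _).trans ?_
  rw [norm_cexp_I_mul_mul, norm_cexp_I_mul_mul]; norm_num

/-- The characteristic function of the occupation measure of one period of the wave. -/
noncomputable def triWaveChar (u : ℝ) : ℂ :=
  ∫ v in (0 : ℝ)..1, Complex.exp (Complex.I * u * triWave v)

lemma norm_triWaveChar_le_one (u : ℝ) : ‖triWaveChar u‖ ≤ 1 := by
  have := intervalIntegral.norm_integral_le_of_norm_le_const (a := 0) (b := 1) (C := 1)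
    (f := fun v : ℝ => Complex.exp (Complex.I * u * triWave v))
    (fun v _ => (norm_cexp_I_mul_mul u _).le)
  simpa [triWaveChar] using this

lemma norm_triWaveChar_le {u : ℝ} (hu : u ≠ 0) : ‖triWaveChar u‖ ≤ 4 / |u| := by
  have hper : Function.Periodic (fun v : ℝ => Complex.exp (Complex.I * u * triWave v)) 1 :=
    fun v => by simp only [triWave_periodic v]
  have hc : Continuous fun v : ℝ => Complex.exp (Complex.I * u * triWave v) := by
    have := continuous_triWave
    fun_prop
  have h1 : triWaveChar u = (∫ v in (-(1 / 2) : ℝ)..0, Complex.exp (Complex.I * (-u : ℝ) * v)) +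
      ∫ v in (0 : ℝ)..(1 / 2), Complex.exp (Complex.I * u * v) := by
    have h := hper.intervalIntegral_add_eq 0 (-(1 / 2))
    rw [zero_add] at h
    unfold triWaveChar
    rw [h, ← intervalIntegral.integral_add_adjacent_intervals
      (hc.intervalIntegrable (-(1 / 2)) 0) (hc.intervalIntegrable 0 _)]
    norm_num only
    congr 1
    · refine intervalIntegral.integral_congr fun v hv => ?_
      rw [uIcc_of_le (by norm_num)] at hv
      rw [triWave_eq_abs (by rw [abs_of_nonpos hv.2]; linarith [hv.1]), abs_of_nonpos hv.2]
      push_cast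
      ring_nf
    · refine intervalIntegral.integral_congr fun v hv => ?_
      rw [uIcc_of_le (by norm_num)] at hv
      rw [triWave_eq_abs (by rw [abs_of_nonneg hv.1]; linarith [hv.2]), abs_of_nonneg hv.1]
  rw [h1]
  refine (norm_add_le _ _).trans ?_
  have a1 := norm_integral_cexp_le (a := -(1 / 2)) (b := 0) (u := -u) (by simpa using hu)
  have a2 := norm_integral_cexp_le (a := 0) (b := 1 / 2) hu
  rw [abs_neg] at a1
  calc _ ≤ 2 / |u| + 2 / |u| := add_le_add a1 a2
    _ = 4 / |u| := by ring

/-- Averaging of a rapidly oscillating periodic factor against a Lipschitz function. -/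
lemma norm_integral_mul_periodic_sub_le {f g : ℝ → ℂ} {K b t : ℝ} (hfc : Continuous f)
    (hf : ∀ x y, ‖f x - f y‖ ≤ K * |x - y|) (hf1 : ∀ x, ‖f x‖ ≤ 1)
    (hgc : Continuous g) (hg : Function.Periodic g 1) (hg1 : ∀ x, ‖g x‖ ≤ 1)
    (hb : 0 < b) (ht : 0 ≤ t) :
    ‖(∫ s in (0 : ℝ)..t, f s * g (b * s)) -
      (∫ v in (0 : ℝ)..1, g v) * ∫ s in (0 : ℝ)..t, f s‖ ≤ (K * t + 2) / b := by
  set A : ℝ → ℂ := fun v => ∫ s in (0 : ℝ)..t, f s * g (b * s + v) with hA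
  have hcA : Continuous A := by
    apply intervalIntegral.continuous_parametric_intervalIntegral_of_continuous'
    simp only [Function.uncurry_def]
    fun_prop
  have havg : ∫ v in (0 : ℝ)..1, A v =
      (∫ v in (0 : ℝ)..1, g v) * ∫ s in (0 : ℝ)..t, f s := by
    have hsw : ∫ v in (0 : ℝ)..1, A v =
        ∫ s in (0 : ℝ)..t, ∫ v in (0 : ℝ)..1, f s * g (b * s + v) := by
      apply MeasureTheory.intervalIntegral_intervalIntegral_swap
      have hc : Continuous (Function.uncurry fun v s : ℝ => f s * g (b * s + v)) := by
        simp only [Function.uncurry_def]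
        fun_prop
      exact (hc.continuousOn.integrableOn_compact
        (isCompact_uIcc.prod isCompact_uIcc)).mono_set
        (prod_mono uIoc_subset_uIcc uIoc_subset_uIcc)
    rw [hsw, mul_comm, ← intervalIntegral.integral_mul_const]
    refine intervalIntegral.integral_congr fun s _ => ?_
    rw [intervalIntegral.integral_const_mul]
    congr 1
    rw [intervalIntegral.integral_comp_add_left (fun v => g v)]
    have := hg.intervalIntegral_add_eq (b * s) 0
    simpa using this
  have hclose : ∀ v ∈ Icc (0 : ℝ) 1, ‖A 0 - A v‖ ≤ (K * t + 2) / b := by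
    intro v hv
    set h : ℝ → ℂ := fun s => f (s - v / b) * g (b * s) with hh
    have hhc : Continuous h := by fun_prop
    have hh1 : ∀ s, ‖h s‖ ≤ 1 := fun s => by
      rw [hh, norm_mul]
      exact mul_le_one₀ (hf1 _) (norm_nonneg _) (hg1 _)
    have hAv : A v = ∫ s in (v / b)..(t + v / b), h s := by
      have := intervalIntegral.integral_comp_add_right (a := 0) (b := t) h (v / b)
      rw [zero_add] at this
      rw [← this]
      refine intervalIntegral.integral_congr fun s _ => ?_
      simp only [hh, add_sub_cancel_right]
      congr 2
      field_simp
    have hi : ∀ p q, IntervalIntegrable h MeasureTheory.volume p q :=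
      fun p q => hhc.intervalIntegrable p q
    have hsplit : A v = (∫ s in (0 : ℝ)..t, h s) + (∫ s in t..(t + v / b), h s) -
        ∫ s in (0 : ℝ)..(v / b), h s := by
      rw [hAv, intervalIntegral.integral_add_adjacent_intervals (hi _ _) (hi _ _),
        ← intervalIntegral.integral_add_adjacent_intervals (hi 0 (v / b)) (hi _ _)]
      ring
    have hA0 : A 0 = ∫ s in (0 : ℝ)..t, f s * g (b * s) := by simp [hA]
    have hvb : 0 ≤ v / b := div_nonneg hv.1 hb.le
    have hvb1 : v / b ≤ 1 / b := by gcongr; exact hv.2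
    have e1 : ‖(∫ s in (0 : ℝ)..t, f s * g (b * s)) - ∫ s in (0 : ℝ)..t, h s‖ ≤
        K * (v / b) * t := by
      rw [← intervalIntegral.integral_sub
        ((by fun_prop : Continuous fun s => f s * g (b * s)).intervalIntegrable _ _) (hi _ _)]
      refine (intervalIntegral.norm_integral_le_of_norm_le_const (C := K * (v / b))
        fun s _ => ?_).trans ?_
      · rw [hh]
        simp only
        rw [← sub_mul, norm_mul]
        have := hf s (s - v / b)
        rw [sub_sub_cancel, abs_of_nonneg hvb] at this
        calc _ ≤ (K * (v / b)) * 1 :=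
              mul_le_mul this (hg1 _) (norm_nonneg _) ((norm_nonneg _).trans this)
          _ = _ := mul_one _
      · rw [sub_zero, abs_of_nonneg ht]
    have e2 : ‖∫ s in t..(t + v / b), h s‖ ≤ v / b := by
      have := intervalIntegral.norm_integral_le_of_norm_le_const (a := t) (b := t + v / b)
        (fun s _ => hh1 s)
      simpa [abs_of_nonneg hvb] using this
    have e3 : ‖∫ s in (0 : ℝ)..(v / b), h s‖ ≤ v / b := by
      have := intervalIntegral.norm_integral_le_of_norm_le_const (a := 0) (b := v / b)
        (fun s _ => hh1 s)
      simpa [abs_of_nonneg hvb] using this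
    have hK : 0 ≤ K := by
      have := (norm_nonneg _).trans (hf 1 0)
      simpa using this
    rw [hsplit, hA0]
    calc _ = ‖((∫ s in (0 : ℝ)..t, f s * g (b * s)) - ∫ s in (0 : ℝ)..t, h s) -
          (∫ s in t..(t + v / b), h s) + ∫ s in (0 : ℝ)..(v / b), h s‖ := by
          congr 1; ring
      _ ≤ K * (v / b) * t + v / b + v / b :=
          (norm_add_le _ _).trans (add_le_add ((norm_sub_le _ _).trans (add_le_add e1 e2)) e3)
      _ = (K * t + 2) * (v / b) := by ring
      _ ≤ (K * t + 2) * (1 / b) := by gcongr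
      _ = _ := by ring
  have hfin : A 0 - ∫ v in (0 : ℝ)..1, A v = ∫ v in (0 : ℝ)..1, (A 0 - A v) := by
    rw [intervalIntegral.integral_sub (by simp) (hcA.intervalIntegrable _ _)]
    simp
  have hA0 : A 0 = ∫ s in (0 : ℝ)..t, f s * g (b * s) := by simp [hA]
  rw [← havg, ← hA0, hfin]
  have := intervalIntegral.norm_integral_le_of_norm_le_const (a := (0 : ℝ)) (b := 1)
    (f := fun v => A 0 - A v) (C := (K * t + 2) / b) (fun v hv => hclose v ?_)
  · simpa using this
  · rw [uIoc_of_le zero_le_one] at hv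
    exact Ioc_subset_Icc_self hv

/-- The oscillating terms of the path. -/
noncomputable def pathTerm (j : ℕ) (s : ℝ) : ℝ := (1 / 2) ^ j * triWave (2 ^ (j + 1) ^ 3 * s)

/-- The partial sums of the path. -/
noncomputable def pathApprox (n : ℕ) (s : ℝ) : ℝ := s + ∑ j ∈ Finset.range n, pathTerm j s

/-- A continuous path whose occupation measure on the circle has a smooth density. -/
noncomputable def roughPath (s : ℝ) : ℝ := s + ∑' j, pathTerm j s

lemma continuous_pathTerm (j : ℕ) : Continuous (pathTerm j) := by
  have := continuous_triWave
  unfold pathTerm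
  fun_prop

lemma norm_pathTerm_le (j : ℕ) (s : ℝ) : ‖pathTerm j s‖ ≤ (1 / 2) ^ j := by
  unfold pathTerm
  rw [norm_mul, Real.norm_of_nonneg (by positivity), Real.norm_of_nonneg (triWave_nonneg _)]
  exact mul_le_of_le_one_right (by positivity) (triWave_le_one _)

lemma summable_pathTerm (s : ℝ) : Summable fun j => pathTerm j s :=
  Summable.of_norm_bounded summable_geometric_two fun j => norm_pathTerm_le j s

lemma continuous_pathApprox (n : ℕ) : Continuous (pathApprox n) :=
  continuous_id.add (continuous_finsetSum _ fun j _ => continuous_pathTerm j)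

lemma continuous_roughPath : Continuous roughPath :=
  continuous_id.add (continuous_tsum continuous_pathTerm summable_geometric_two norm_pathTerm_le)

lemma tendsto_pathApprox (s : ℝ) :
    Filter.Tendsto (fun n => pathApprox n s) Filter.atTop (nhds (roughPath s)) :=
  (summable_pathTerm s).hasSum.tendsto_sum_nat.const_add s

lemma pathTerm_add_one (j : ℕ) (s : ℝ) : pathTerm j (s + 1) = pathTerm j s := by
  unfold pathTerm
  have := triWave_periodic.nat_mul (2 ^ (j + 1) ^ 3) (2 ^ (j + 1) ^ 3 * s)
  rw [mul_add, mul_one]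
  push_cast at this
  rw [mul_one] at this
  rw [this]

lemma roughPath_add_one (s : ℝ) : roughPath (s + 1) = roughPath s + 1 := by
  unfold roughPath
  simp only [pathTerm_add_one]
  ring

lemma roughPath_zero : roughPath 0 = 0 := by
  have : triWave 0 = 0 := by simpa using triWave_nat 0
  simp [roughPath, pathTerm, this]

lemma roughPath_add_nat (s : ℝ) (n : ℕ) : roughPath (s + n) = roughPath s + n := by
  induction n with
  | zero => simp
  | succ n ih =>
    push_cast
    rw [← add_assoc, roughPath_add_one, ih, add_assoc]

lemma roughPath_nat (n : ℕ) : roughPath n = n := by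
  have := roughPath_add_nat 0 n
  simpa [roughPath_zero] using this

/-- A Lipschitz constant for the partial sums. -/
noncomputable def pathLip (n : ℕ) : ℝ :=
  1 + ∑ j ∈ Finset.range n, (1 / 2) ^ j * 2 ^ (j + 1) ^ 3

lemma one_le_pathLip (n : ℕ) : 1 ≤ pathLip n :=
  le_add_of_nonneg_right (Finset.sum_nonneg fun _ _ => by positivity)

lemma pathLip_le (n : ℕ) : pathLip n ≤ 2 * 2 ^ n ^ 3 := by
  induction n with
  | zero => simp [pathLip]
  | succ n ih =>
    have h1 : pathLip (n + 1) = pathLip n + (1 / 2) ^ n * 2 ^ (n + 1) ^ 3 := by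
      simp only [pathLip, Finset.sum_range_succ]; ring
    have h2 : (1 / 2 : ℝ) ^ n ≤ 1 := pow_le_one₀ (by norm_num) (by norm_num)
    have h3 : (2 : ℝ) * 2 ^ n ^ 3 ≤ 2 ^ (n + 1) ^ 3 := by
      rw [← pow_succ']
      exact pow_le_pow_right₀ (by norm_num) (by ring_nf; omega)
    have h4 : (1 / 2 : ℝ) ^ n * 2 ^ (n + 1) ^ 3 ≤ 1 * 2 ^ (n + 1) ^ 3 := by gcongr
    linarith

lemma pathLip_div_le (n : ℕ) : pathLip n / 2 ^ (n + 1) ^ 3 ≤ 2 * (1 / 2) ^ n ^ 2 := by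
  rw [div_le_iff₀ (by positivity)]
  refine (pathLip_le n).trans ?_
  have : (2 : ℝ) ^ (n + 1) ^ 3 = 2 ^ n ^ 2 * 2 ^ ((n + 1) ^ 3 - n ^ 2) := by
    rw [← pow_add]
    congr 1
    have : n ^ 2 ≤ (n + 1) ^ 3 := by nlinarith [sq_nonneg n, Nat.zero_le (n ^ 3)]
    omega
  rw [this, mul_assoc, ← mul_assoc ((1 / 2 : ℝ) ^ n ^ 2), ← mul_pow]
  norm_num
  refine pow_le_pow_right₀ (by norm_num) ?_
  have : (n + 1) ^ 3 = n ^ 3 + 3 * n ^ 2 + 3 * n + 1 := by ring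
  omega

lemma abs_pathApprox_sub_le (n : ℕ) (x y : ℝ) :
    |pathApprox n x - pathApprox n y| ≤ pathLip n * |x - y| := by
  have h : pathApprox n x - pathApprox n y =
      (x - y) + ∑ j ∈ Finset.range n, (pathTerm j x - pathTerm j y) := by
    simp only [pathApprox, Finset.sum_sub_distrib]; ring
  rw [h, pathLip, add_mul, one_mul, Finset.sum_mul]
  refine (abs_add_le _ _).trans (add_le_add le_rfl ((Finset.abs_sum_le_sum_abs _ _).trans
    (Finset.sum_le_sum fun j _ => ?_)))
  unfold pathTerm
  rw [← mul_sub, abs_mul, abs_of_nonneg (by positivity : (0 : ℝ) ≤ (1 / 2) ^ j), mul_assoc]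
  gcongr
  refine (triWave_sub_le _ _).trans ?_
  rw [← mul_sub, abs_mul, abs_of_nonneg (by positivity : (0 : ℝ) ≤ 2 ^ (j + 1) ^ 3)]

/-- Fourier coefficients of the occupation measure of the approximating paths. -/
noncomputable def occApprox (n : ℕ) (k t : ℝ) : ℂ :=
  ∫ s in (0 : ℝ)..t, Complex.exp (Complex.I * k * pathApprox n s)

lemma norm_cexp_sub_le (k x y : ℝ) :
    ‖Complex.exp (Complex.I * k * x) - Complex.exp (Complex.I * k * y)‖ ≤ |k| * |x - y| := by
  have h : Complex.exp (Complex.I * k * x) - Complex.exp (Complex.I * k * y) =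
      Complex.exp (Complex.I * k * y) *
        (Complex.exp (Complex.I * ((k * (x - y) : ℝ) : ℂ)) - 1) := by
    rw [mul_sub, ← Complex.exp_add, mul_one]
    congr 2
    push_cast
    ring
  rw [h, norm_mul, norm_cexp_I_mul_mul, one_mul, ← abs_mul]
  exact Real.norm_exp_I_mul_ofReal_sub_one_le

lemma norm_occApprox_succ_le {k t T : ℝ} (hk : 1 ≤ |k|) (ht : t ∈ Icc 0 T) (n : ℕ) :
    ‖occApprox (n + 1) k t‖ ≤ ‖triWaveChar (k * (1 / 2) ^ n)‖ * ‖occApprox n k t‖ +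
      2 * |k| * (T + 2) * (1 / 2) ^ n ^ 2 := by
  have hc := continuous_pathApprox n
  have hw := continuous_triWave
  have key := norm_integral_mul_periodic_sub_le
    (f := fun s => Complex.exp (Complex.I * k * pathApprox n s))
    (g := fun v => Complex.exp (Complex.I * (k * (1 / 2) ^ n : ℝ) * triWave v))
    (K := |k| * pathLip n) (b := 2 ^ (n + 1) ^ 3) (t := t) (by fun_prop)
    (fun x y => (norm_cexp_sub_le _ _ _).trans (by
      rw [mul_assoc]; gcongr; exact abs_pathApprox_sub_le n x y))
    (fun x => (norm_cexp_I_mul_mul _ _).le) (by fun_prop)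
    (fun v => by simp only [triWave_periodic v]) (fun x => (norm_cexp_I_mul_mul _ _).le)
    (by positivity) ht.1
  have e1 : occApprox (n + 1) k t = ∫ s in (0 : ℝ)..t,
      Complex.exp (Complex.I * k * pathApprox n s) *
        Complex.exp (Complex.I * (k * (1 / 2) ^ n : ℝ) * triWave (2 ^ (n + 1) ^ 3 * s)) := by
    refine intervalIntegral.integral_congr fun s _ => ?_
    rw [← Complex.exp_add]
    congr 1
    simp only [pathApprox, Finset.sum_range_succ, pathTerm]
    push_cast
    ring
  rw [← e1] at key
  change ‖occApprox (n + 1) k t - triWaveChar (k * (1 / 2) ^ n) * occApprox n k t‖ ≤ _ at key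
  have hB := one_le_pathLip n
  have herr : (|k| * pathLip n * t + 2) / 2 ^ (n + 1) ^ 3 ≤
      2 * |k| * (T + 2) * (1 / 2) ^ n ^ 2 := by
    have hkB : 1 ≤ |k| * pathLip n := one_le_mul_of_one_le_of_one_le hk hB
    have h2 : |k| * pathLip n * t + 2 ≤ |k| * (T + 2) * pathLip n := by
      nlinarith [mul_le_mul_of_nonneg_left ht.2 (zero_le_one.trans hkB)]
    have hT : 0 ≤ T := ht.1.trans ht.2
    calc _ ≤ |k| * (T + 2) * pathLip n / 2 ^ (n + 1) ^ 3 := by gcongr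
      _ = |k| * (T + 2) * (pathLip n / 2 ^ (n + 1) ^ 3) := by ring
      _ ≤ |k| * (T + 2) * (2 * (1 / 2) ^ n ^ 2) := by gcongr; exact pathLip_div_le n
      _ = _ := by ring
  have := norm_le_norm_add_norm_sub' (occApprox (n + 1) k t)
    (triWaveChar (k * (1 / 2) ^ n) * occApprox n k t)
  rw [norm_mul] at this
  linarith

lemma norm_occApprox_le {k t T : ℝ} (ht : t ∈ Icc 0 T) (n : ℕ) : ‖occApprox n k t‖ ≤ T := by
  have := intervalIntegral.norm_integral_le_of_norm_le_const (a := 0) (b := t) (C := 1)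
    (f := fun s : ℝ => Complex.exp (Complex.I * k * pathApprox n s))
    (fun v _ => (norm_cexp_I_mul_mul _ _).le)
  rw [sub_zero, abs_of_nonneg ht.1, one_mul] at this
  exact this.trans ht.2

lemma norm_occApprox_add_le {k t T : ℝ} (hk : 1 ≤ |k|) (ht : t ∈ Icc 0 T) (p m i : ℕ)
    (hi : i ≤ m) :
    ‖occApprox (p + i) k t‖ ≤ (4 * 2 ^ (p + m) / |k|) ^ i * T +
      ∑ j ∈ Finset.range i, 2 * |k| * (T + 2) * (1 / 2) ^ (p + j) ^ 2 := by
  induction i with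
  | zero => simpa using norm_occApprox_le ht p
  | succ i ih =>
    have hT : 0 ≤ T := ht.1.trans ht.2
    have hk0 : 0 < |k| := zero_lt_one.trans_le hk
    refine (norm_occApprox_succ_le hk ht (p + i)).trans ?_
    rw [Finset.sum_range_succ, ← add_assoc]
    gcongr
    have h1 := norm_triWaveChar_le_one (k * (1 / 2) ^ (p + i))
    have h2 : ‖triWaveChar (k * (1 / 2) ^ (p + i))‖ ≤ 4 * 2 ^ (p + m) / |k| := by
      refine (norm_triWaveChar_le (mul_ne_zero (abs_pos.1 hk0) (by positivity))).trans ?_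
      rw [abs_mul, abs_of_nonneg (by positivity : (0 : ℝ) ≤ (1 / 2) ^ (p + i)),
        div_le_div_iff₀ (by positivity) hk0]
      have h3 : (2 : ℝ) ^ (p + i) ≤ 2 ^ (p + m) :=
        pow_le_pow_right₀ (by norm_num) (by omega)
      have h4 : (1 / 2 : ℝ) ^ (p + i) * 2 ^ (p + i) = 1 := by rw [← mul_pow]; norm_num
      have h5 : (0 : ℝ) < (1 / 2) ^ (p + i) := by positivity
      calc 4 * |k| = 4 * |k| * ((1 / 2 : ℝ) ^ (p + i) * 2 ^ (p + i)) := by rw [h4, mul_one]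
        _ ≤ 4 * |k| * ((1 / 2 : ℝ) ^ (p + i) * 2 ^ (p + m)) := by gcongr
        _ = _ := by ring
    have hE : 0 ≤ ∑ j ∈ Finset.range i, 2 * |k| * (T + 2) * (1 / 2) ^ (p + j) ^ 2 :=
      Finset.sum_nonneg fun _ _ => by positivity
    calc _ ≤ ‖triWaveChar (k * (1 / 2) ^ (p + i))‖ * ((4 * 2 ^ (p + m) / |k|) ^ i * T +
          ∑ j ∈ Finset.range i, 2 * |k| * (T + 2) * (1 / 2) ^ (p + j) ^ 2) := by
          gcongr; exact ih (by omega)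
      _ ≤ (4 * 2 ^ (p + m) / |k|) * ((4 * 2 ^ (p + m) / |k|) ^ i * T) +
          1 * ∑ j ∈ Finset.range i, 2 * |k| * (T + 2) * (1 / 2) ^ (p + j) ^ 2 := by
          rw [mul_add]; gcongr
      _ = _ := by ring

lemma norm_occApprox_tail_le {k t T : ℝ} (hk : 1 ≤ |k|) (ht : t ∈ Icc 0 T) (p m l : ℕ) :
    ‖occApprox (p + m + l) k t‖ ≤ (4 * 2 ^ (p + m) / |k|) ^ m * T +
      ∑ j ∈ Finset.range (m + l), 2 * |k| * (T + 2) * (1 / 2) ^ (p + j) ^ 2 := by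
  induction l with
  | zero => simpa using norm_occApprox_add_le hk ht p m m le_rfl
  | succ l ih =>
    refine (norm_occApprox_succ_le hk ht (p + m + l)).trans ?_
    rw [← add_assoc, Finset.sum_range_succ, ← add_assoc, ← add_assoc]
    gcongr
    exact (mul_le_of_le_one_left (norm_nonneg _) (norm_triWaveChar_le_one _)).trans ih

lemma sum_half_pow_sq_le (p n : ℕ) :
    ∑ j ∈ Finset.range n, (1 / 2 : ℝ) ^ (p + j) ^ 2 ≤ 2 * (1 / 2) ^ p ^ 2 := by
  calc _ ≤ ∑ j ∈ Finset.range n, (1 / 2 : ℝ) ^ p ^ 2 * (1 / 2) ^ j := by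
        refine Finset.sum_le_sum fun j _ => ?_
        rw [← pow_add]
        refine pow_le_pow_of_le_one (by norm_num) (by norm_num) ?_
        have : j ≤ j ^ 2 := Nat.le_self_pow (by norm_num) j
        nlinarith [Nat.zero_le (p * j)]
    _ = (1 / 2 : ℝ) ^ p ^ 2 * ∑ j ∈ Finset.range n, (1 / 2 : ℝ) ^ j := by rw [Finset.mul_sum]
    _ ≤ (1 / 2 : ℝ) ^ p ^ 2 * 2 := by
        gcongr
        refine le_of_le_of_eq ?_ tsum_geometric_two
        exact summable_geometric_two.sum_le_tsum _ fun _ _ => by positivity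
    _ = _ := mul_comm _ _

/-- Fourier coefficients of the occupation measure of the path. -/
noncomputable def occCoeff (k t : ℝ) : ℂ :=
  ∫ s in (0 : ℝ)..t, Complex.exp (Complex.I * k * roughPath s)

lemma tendsto_occApprox (k t : ℝ) :
    Filter.Tendsto (fun n => occApprox n k t) Filter.atTop (nhds (occCoeff k t)) := by
  refine intervalIntegral.tendsto_integral_filter_of_dominated_convergence (fun _ => 1)
    (.of_forall fun n => ?_) (.of_forall fun n => .of_forall fun s _ => ?_) (by simp)
    (.of_forall fun s _ => ?_)
  · have := continuous_pathApprox n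
    exact (by fun_prop : Continuous fun s : ℝ =>
      Complex.exp (Complex.I * k * pathApprox n s)).aestronglyMeasurable
  · exact (norm_cexp_I_mul_mul _ _).le
  · have h : Continuous fun x : ℝ => Complex.exp (Complex.I * k * x) := by fun_prop
    exact (h.tendsto _).comp (tendsto_pathApprox s)

lemma norm_occCoeff_le_aux {k t T : ℝ} (hk : 1 ≤ |k|) (ht : t ∈ Icc 0 T) (p m : ℕ) :
    ‖occCoeff k t‖ ≤ (4 * 2 ^ (p + m) / |k|) ^ m * T +
      4 * |k| * (T + 2) * (1 / 2) ^ p ^ 2 := by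
  refine le_of_tendsto (tendsto_occApprox k t).norm ?_
  filter_upwards [Filter.eventually_ge_atTop (p + m)] with n hn
  obtain ⟨l, rfl⟩ := Nat.exists_eq_add_of_le hn
  refine (norm_occApprox_tail_le hk ht p m l).trans ?_
  have hT : 0 ≤ T := ht.1.trans ht.2
  rw [← Finset.mul_sum]
  refine add_le_add le_rfl ?_
  calc _ ≤ 2 * |k| * (T + 2) * (2 * (1 / 2) ^ p ^ 2) := by
        gcongr; exact sum_half_pow_sq_le _ _
    _ = _ := by ring

/-- The Fourier coefficients of the occupation measure decay faster than any power. -/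
lemma exists_norm_occCoeff_le (T : ℝ) (r : ℕ) : ∃ C : ℝ, ∀ k t : ℝ, 1 ≤ |k| → t ∈ Icc 0 T →
    |k| ^ r * ‖occCoeff k t‖ ≤ C := by
  refine ⟨(4 * 2 ^ (2 * r)) ^ (2 * r) * 4 ^ r * T +
    4 * (T + 2) * (4 ^ (r + 1) * 2 ^ (r + 1) ^ 2), fun k t hk ht => ?_⟩
  have hT : 0 ≤ T := ht.1.trans ht.2
  have hk0 : 0 < |k| := zero_lt_one.trans_le hk
  obtain ⟨p, hp1, hp2⟩ := exists_nat_pow_near hk (by norm_num : (1 : ℝ) < 4)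
  have hY : (4 : ℝ) ^ p = (2 ^ p) ^ 2 := by rw [← pow_mul, mul_comm, pow_mul]; norm_num
  have hpos : (0 : ℝ) < 2 ^ p := by positivity
  have hk4 : |k| ≤ 4 * (2 ^ p) ^ 2 := by rw [← hY, ← pow_succ']; exact hp2.le
  rw [hY] at hp1
  have hmain := norm_occCoeff_le_aux hk ht p (2 * r)
  have e1 : |k| ^ r * (4 * 2 ^ (p + 2 * r) / |k|) ^ (2 * r) ≤
      (4 * 2 ^ (2 * r)) ^ (2 * r) * 4 ^ r := by
    have h1 : 4 * 2 ^ (p + 2 * r) / |k| ≤ 4 * 2 ^ (2 * r) / 2 ^ p := by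
      rw [div_le_div_iff₀ hk0 hpos, pow_add]
      calc 4 * (2 ^ p * 2 ^ (2 * r)) * 2 ^ p = 4 * 2 ^ (2 * r) * (2 ^ p : ℝ) ^ 2 := by ring
        _ ≤ _ := by gcongr
    calc |k| ^ r * (4 * 2 ^ (p + 2 * r) / |k|) ^ (2 * r) ≤
        (4 * (2 ^ p) ^ 2) ^ r * (4 * 2 ^ (2 * r) / 2 ^ p) ^ (2 * r) := by gcongr
      _ = (4 * 2 ^ (2 * r)) ^ (2 * r) * 4 ^ r := by
        rw [div_pow, mul_pow 4, ← pow_mul (2 ^ p : ℝ) 2 r]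
        field_simp
  have e2 : |k| ^ r * (|k| * (1 / 2) ^ p ^ 2) ≤ 4 ^ (r + 1) * 2 ^ (r + 1) ^ 2 := by
    calc |k| ^ r * (|k| * (1 / 2) ^ p ^ 2) = |k| ^ (r + 1) * (1 / 2) ^ p ^ 2 := by ring
      _ ≤ (4 * (2 ^ p) ^ 2) ^ (r + 1) * (1 / 2) ^ p ^ 2 := by gcongr
      _ = 4 ^ (r + 1) * (2 ^ (2 * p * (r + 1)) * (1 / 2) ^ p ^ 2) := by
        rw [mul_pow, ← pow_mul, ← pow_mul]; ring_nf
      _ ≤ 4 ^ (r + 1) * (2 ^ (p ^ 2 + (r + 1) ^ 2) * (1 / 2) ^ p ^ 2) := by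
        gcongr
        · norm_num
        · zify; nlinarith [sq_nonneg ((p : ℤ) - (r + 1))]
      _ = _ := by
        rw [pow_add 2 (p ^ 2), mul_right_comm, ← mul_pow]; norm_num
  calc |k| ^ r * ‖occCoeff k t‖ ≤ |k| ^ r * ((4 * 2 ^ (p + 2 * r) / |k|) ^ (2 * r) * T +
        4 * |k| * (T + 2) * (1 / 2) ^ p ^ 2) := by gcongr
    _ = (|k| ^ r * (4 * 2 ^ (p + 2 * r) / |k|) ^ (2 * r)) * T +
        4 * (T + 2) * (|k| ^ r * (|k| * (1 / 2) ^ p ^ 2)) := by ring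
    _ ≤ _ := by gcongr

instance factTwoPiPos : Fact (0 < 2 * Real.pi) := ⟨Real.two_pi_pos⟩

lemma fourier_coe_realTorus (k : ℤ) (y : ℝ) :
    fourier k (y : RealTorus) = Complex.exp (Complex.I * k * y) := by
  have : (Real.pi : ℂ) ≠ 0 := by exact_mod_cast Real.pi_ne_zero
  rw [fourier_coe_apply]
  congr 1
  push_cast
  field_simp

lemma continuous_occCoeff (k : ℝ) : Continuous (occCoeff k) := by
  have := continuous_roughPath
  exact intervalIntegral.continuous_primitive
    (fun a b => (by fun_prop : Continuous fun s : ℝ =>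
      Complex.exp (Complex.I * k * roughPath s)).intervalIntegrable a b) 0

lemma norm_occCoeff_le {k t T : ℝ} (ht : t ∈ Icc 0 T) : ‖occCoeff k t‖ ≤ T := by
  have := intervalIntegral.norm_integral_le_of_norm_le_const (a := 0) (b := t) (C := 1)
    (f := fun s : ℝ => Complex.exp (Complex.I * k * roughPath s))
    (fun v _ => (norm_cexp_I_mul_mul _ _).le)
  rw [sub_zero, abs_of_nonneg ht.1, one_mul] at this
  exact this.trans ht.2

lemma exists_summable_occCoeff_bound (T : ℝ) (i : ℕ) : ∃ u : ℤ → ℝ, Summable u ∧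
    ∀ k : ℤ, ∀ t ∈ Icc 0 T, |(k : ℝ)| ^ i * ‖occCoeff (-k) t‖ ≤ u k := by
  obtain ⟨C, hC⟩ := exists_norm_occCoeff_le T (i + 2)
  refine ⟨fun k => C * (1 / (k : ℝ) ^ 2) + if k = 0 then T else 0, ?_, fun k t ht => ?_⟩
  · refine ((Real.summable_one_div_int_pow.2 (by norm_num)).mul_left C).add
      (summable_of_hasFiniteSupport ?_)
    refine (finite_singleton (0 : ℤ)).subset fun k hk => ?_
    by_contra h
    simp at h
    simp [h] at hk
  · rcases eq_or_ne k 0 with rfl | hk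
    · have h1 := norm_occCoeff_le (k := -((0 : ℤ) : ℝ)) ht
      have h2 : |((0 : ℤ) : ℝ)| ^ i ≤ 1 := pow_le_one₀ (by simp) (by simp)
      have := mul_le_mul h2 h1 (norm_nonneg _) zero_le_one
      simpa using this
    · have h1 : (1 : ℝ) ≤ |(k : ℝ)| := by exact_mod_cast Int.one_le_abs hk
      have h2 := hC (-k) t (by rwa [abs_neg]) ht
      have h0 : (0 : ℝ) < |(k : ℝ)| ^ 2 := by positivity
      beta_reduce
      rw [if_neg hk, add_zero, ← sq_abs (k : ℝ), mul_one_div, le_div_iff₀ h0]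
      rw [abs_neg] at h2
      calc _ = |(k : ℝ)| ^ (i + 2) * ‖occCoeff (-k) t‖ := by ring
        _ ≤ C := h2

/-- The terms of the Fourier series of the derivatives of the occupation density. -/
noncomputable def occTerm (i : ℕ) (k : ℤ) (t : ℝ) (x : RealTorus) : ℂ :=
  occCoeff (-k) t * (Complex.I * k) ^ i * fourier k x

/-- The `i`-th derivative of the occupation density up to time `t`, as a complex number. -/
noncomputable def occSeries (i : ℕ) (t : ℝ) (x : RealTorus) : ℂ := ∑' k : ℤ, occTerm i k t x

/-- The `i`-th derivative of the occupation density (times `2π`) of the path up to time `t`. -/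
noncomputable def occDensity (i : ℕ) (t : ℝ) (x : RealTorus) : ℝ := (occSeries i t x).re

lemma norm_occTerm (i : ℕ) (k : ℤ) (t : ℝ) (x : RealTorus) :
    ‖occTerm i k t x‖ = |(k : ℝ)| ^ i * ‖occCoeff (-k) t‖ := by
  have : ‖fourier k x‖ = 1 := by rw [fourier_apply]; exact Circle.norm_coe _
  rw [occTerm, norm_mul, norm_mul, norm_pow, this]
  simp [mul_comm]

lemma summable_occTerm (i : ℕ) {t : ℝ} (ht : 0 ≤ t) (x : RealTorus) :
    Summable fun k => occTerm i k t x := by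
  obtain ⟨u, hu, hb⟩ := exists_summable_occCoeff_bound t i
  exact Summable.of_norm_bounded hu fun k => (norm_occTerm i k t x).trans_le
    (hb k t (right_mem_Icc.2 ht))

lemma continuousOn_occSeries (i : ℕ) (T : ℝ) :
    ContinuousOn (fun p : ℝ × RealTorus => occSeries i p.1 p.2) (Icc 0 T ×ˢ univ) := by
  obtain ⟨u, hu, hb⟩ := exists_summable_occCoeff_bound T i
  refine continuousOn_tsum (fun k => Continuous.continuousOn ?_) hu
    fun k p hp => (norm_occTerm i k p.1 p.2).trans_le (hb k p.1 hp.1)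
  have := continuous_occCoeff (-k)
  unfold occTerm
  fun_prop

lemma continuousOn_occDensity (i : ℕ) (T : ℝ) :
    ContinuousOn (fun p : ℝ × RealTorus => occDensity i p.1 p.2) (Icc 0 T ×ˢ univ) :=
  Complex.continuous_re.comp_continuousOn (continuousOn_occSeries i T)

lemma continuous_occSeries (i : ℕ) {t : ℝ} (ht : 0 ≤ t) : Continuous (occSeries i t) := by
  rw [← continuousOn_univ]
  exact (continuousOn_occSeries i t).comp (f := fun x : RealTorus => (t, x)) (by fun_prop)
    fun x _ => ⟨right_mem_Icc.2 ht, mem_univ _⟩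

lemma continuous_occDensity (i : ℕ) {t : ℝ} (ht : 0 ≤ t) : Continuous (occDensity i t) :=
  Complex.continuous_re.comp (continuous_occSeries i ht)

lemma hasDerivAt_occDensity (i : ℕ) {t : ℝ} (ht : 0 ≤ t) (y : ℝ) :
    HasDerivAt (fun y : ℝ => occDensity i t (y : RealTorus)) (occDensity (i + 1) t y) y := by
  obtain ⟨u, hu, hb⟩ := exists_summable_occCoeff_bound t (i + 1)
  have h : HasDerivAt (fun y : ℝ => occSeries i t (y : RealTorus)) (occSeries (i + 1) t y) y := by
    refine hasDerivAt_tsum (𝕜 := ℝ) (y₀ := (0 : ℝ)) hu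
      (g := fun k (y : ℝ) => occTerm i k t (y : RealTorus))
      (g' := fun k (y : ℝ) => occTerm (i + 1) k t (y : RealTorus))
      (fun k y => ?_) (fun k y => ?_) (summable_occTerm i ht _) y
    · simp only [occTerm, fourier_coe_realTorus]
      have h1 : HasDerivAt (fun y : ℝ => Complex.I * (k : ℂ) * (y : ℂ)) (Complex.I * k) y := by
        simpa using (Complex.ofRealCLM.hasDerivAt (x := y)).const_mul (Complex.I * (k : ℂ))
      refine (h1.cexp.const_mul (occCoeff (-k) t * (Complex.I * k) ^ i)).congr_deriv ?_
      rw [pow_succ]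
      ring
    · exact (norm_occTerm _ k t _).trans_le (hb k t (right_mem_Icc.2 ht))
  exact (Complex.reCLM.hasFDerivAt.comp_hasDerivAt y h)

lemma iteratedDeriv_occDensity (i : ℕ) {t : ℝ} (ht : 0 ≤ t) :
    iteratedDeriv i (fun y : ℝ => occDensity 0 t (y : RealTorus)) =
      fun y : ℝ => occDensity i t (y : RealTorus) := by
  induction i with
  | zero => simp
  | succ i ih =>
    rw [iteratedDeriv_succ, ih]
    exact funext fun y => (hasDerivAt_occDensity i ht y).deriv

lemma contDiff_occDensity {t : ℝ} (ht : 0 ≤ t) :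
    ContDiff ℝ (⊤ : ℕ∞) (fun y : ℝ => occDensity 0 t (y : RealTorus)) := by
  refine contDiff_of_differentiable_iteratedDeriv fun m _ => ?_
  rw [iteratedDeriv_occDensity m ht]
  exact fun y => (hasDerivAt_occDensity m ht y).differentiableAt

lemma exists_abs_occDensity_sub_lt (T : ℝ) (i : ℕ) {ε : ℝ} (hε : 0 < ε) :
    ∃ δ > 0, ∀ t ∈ Icc 0 T, ∀ s ∈ Icc 0 T, |s - t| < δ → ∀ x,
      |occDensity i s x - occDensity i t x| < ε := by
  have h := (isCompact_Icc.prod isCompact_univ).uniformContinuousOn_of_continuous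
    (continuousOn_occDensity i T)
  obtain ⟨δ, hδ, H⟩ := Metric.uniformContinuousOn_iff.1 h ε hε
  refine ⟨δ, hδ, fun t ht s hs hst x => ?_⟩
  exact H (s, x) ⟨hs, mem_univ _⟩ (t, x) ⟨ht, mem_univ _⟩ (by
    rw [Prod.dist_eq]; simpa [Real.dist_eq, hδ] using hst)

lemma integral_fourier_realTorus (m : ℤ) :
    ∫ y in (0 : ℝ)..(2 * Real.pi), fourier m (y : RealTorus) =
      if m = 0 then 2 * (Real.pi : ℂ) else 0 := by
  simp only [fourier_coe_realTorus]
  split_ifs with hm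
  · simp [hm]
  · rw [integral_exp_mul_complex (by simp [hm])]
    have : Complex.exp (Complex.I * m * ((2 * Real.pi : ℝ) : ℂ)) = 1 := by
      rw [← Complex.exp_int_mul_two_pi_mul_I m]
      congr 1
      push_cast
      ring
    rw [this]
    simp

lemma integral_fourier_mul_occSeries (n : ℤ) {t : ℝ} (ht : 0 ≤ t) :
    ∫ y in (0 : ℝ)..(2 * Real.pi), fourier n (y : RealTorus) * occSeries 0 t y =
      2 * Real.pi * occCoeff n t := by
  obtain ⟨u, hu, hb⟩ := exists_summable_occCoeff_bound t 0
  have hq : Continuous fun y : ℝ => (y : RealTorus) := AddCircle.continuous_mk' _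
  have h1 : HasSum (fun k : ℤ => ∫ y in (0 : ℝ)..(2 * Real.pi),
      fourier n (y : RealTorus) * occTerm 0 k t y)
      (∫ y in (0 : ℝ)..(2 * Real.pi), fourier n (y : RealTorus) * occSeries 0 t y) := by
    refine intervalIntegral.hasSum_integral_of_dominated_convergence (fun k _ => u k)
      (fun k => Continuous.aestronglyMeasurable ?_) (fun k => .of_forall fun y _ => ?_)
      (.of_forall fun _ _ => hu) (by simp) (.of_forall fun y _ => ?_)
    · unfold occTerm
      fun_prop
    · have : ‖fourier n (y : RealTorus)‖ = 1 := by rw [fourier_apply]; exact Circle.norm_coe _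
      rw [norm_mul, this, one_mul]
      exact (norm_occTerm _ k t _).trans_le (hb k t (right_mem_Icc.2 ht))
    · exact (summable_occTerm 0 ht _).hasSum.mul_left _
  have h2 : ∀ k : ℤ, ∫ y in (0 : ℝ)..(2 * Real.pi),
      fourier n (y : RealTorus) * occTerm 0 k t y =
        if k = -n then 2 * Real.pi * occCoeff n t else 0 := by
    intro k
    have : ∀ y : ℝ, fourier n (y : RealTorus) * occTerm 0 k t y =
        occCoeff (-k) t * fourier (n + k) (y : RealTorus) := fun y => by
      rw [occTerm, fourier_add]; ring
    simp only [this]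
    rw [intervalIntegral.integral_const_mul, integral_fourier_realTorus]
    by_cases hk : k = -n
    · subst hk
      simp [mul_comm]
    · rw [if_neg hk, if_neg (by omega), mul_zero]
  simp only [h2] at h1
  exact h1.unique (hasSum_ite_eq (-n) _)

/-- Integrating a test function against the occupation density amounts to integrating it along
the path. -/
lemma integral_mul_occSeries (g : C(RealTorus, ℂ)) {t : ℝ} (ht : 0 ≤ t) :
    ∫ y in (0 : ℝ)..(2 * Real.pi), g (y : RealTorus) * occSeries 0 t y =
      2 * Real.pi * ∫ r in (0 : ℝ)..t, g (roughPath r : RealTorus) := by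
  have hq : Continuous fun y : ℝ => (y : RealTorus) := AddCircle.continuous_mk' _
  have hX := continuous_roughPath
  have hS := continuous_occSeries 0 ht
  have hcl : IsClosed {g : C(RealTorus, ℂ) |
      ∫ y in (0 : ℝ)..(2 * Real.pi), g (y : RealTorus) * occSeries 0 t y =
      2 * Real.pi * ∫ r in (0 : ℝ)..t, g (roughPath r : RealTorus)} := by
    refine isClosed_eq ?_ (continuous_const.mul ?_)
    · apply intervalIntegral.continuous_parametric_intervalIntegral_of_continuous'
      simp only [Function.uncurry_def]
      fun_prop
    · apply intervalIntegral.continuous_parametric_intervalIntegral_of_continuous'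
      simp only [Function.uncurry_def]
      fun_prop
  have hmem : g ∈ (Submodule.span ℂ (range (fourier (T := 2 * Real.pi)))).topologicalClosure := by
    rw [span_fourier_closure_eq_top]; trivial
  refine closure_minimal (fun f hf => ?_) hcl hmem
  have hi : ∀ f : C(RealTorus, ℂ), IntervalIntegrable
      (fun y : ℝ => f (y : RealTorus) * occSeries 0 t y) MeasureTheory.volume 0 (2 * Real.pi) :=
    fun f => Continuous.intervalIntegrable (by fun_prop) _ _
  have hi' : ∀ f : C(RealTorus, ℂ), IntervalIntegrable
      (fun r : ℝ => f (roughPath r : RealTorus)) MeasureTheory.volume 0 t :=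
    fun f => Continuous.intervalIntegrable (by fun_prop) _ _
  refine Submodule.span_induction (p := fun f _ => f ∈ _) ?_ ?_ ?_ ?_ hf
  · rintro _ ⟨n, rfl⟩
    rw [mem_ofPred_eq, integral_fourier_mul_occSeries n ht]
    congr 1
    refine intervalIntegral.integral_congr fun r _ => ?_
    simp only [fourier_coe_realTorus, Complex.ofReal_intCast]
  · simp
  · intro f₁ f₂ _ _ h₁ h₂
    simp only [mem_ofPred_eq, ContinuousMap.add_apply, add_mul] at h₁ h₂ ⊢
    rw [intervalIntegral.integral_add (hi _) (hi _), intervalIntegral.integral_add (hi' _) (hi' _),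
      h₁, h₂, mul_add]
  · intro a f₁ _ h₁
    simp only [mem_ofPred_eq, ContinuousMap.smul_apply, smul_eq_mul, mul_assoc] at h₁ ⊢
    rw [intervalIntegral.integral_const_mul, intervalIntegral.integral_const_mul, h₁]
    ring

lemma integral_mul_occDensity {g : RealTorus → ℝ} (hg : Continuous g) {t : ℝ} (ht : 0 ≤ t) :
    ∫ y in (0 : ℝ)..(2 * Real.pi), g y * occDensity 0 t y =
      2 * Real.pi * ∫ r in (0 : ℝ)..t, g (roughPath r : RealTorus) := by
  have hq : Continuous fun y : ℝ => (y : RealTorus) := AddCircle.continuous_mk' _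
  have hS := continuous_occSeries 0 ht
  have h := integral_mul_occSeries ⟨fun x => (g x : ℂ), by fun_prop⟩ ht
  simp only [ContinuousMap.coe_mk, intervalIntegral.integral_ofReal] at h
  have h' := congrArg Complex.re h
  have e1 : (∫ y in (0 : ℝ)..(2 * Real.pi), (g y : ℂ) * occSeries 0 t y).re =
      ∫ y in (0 : ℝ)..(2 * Real.pi), g y * occDensity 0 t y := by
    rw [← Complex.reCLM_apply, ← ContinuousLinearMap.intervalIntegral_comp_comm]
    · simp [occDensity]
    · exact Continuous.intervalIntegrable (by fun_prop) _ _
  rw [e1] at h'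
  rw [h']
  norm_cast

lemma integral_mul_occDensity_sub {g : RealTorus → ℝ} (hg : Continuous g) {s t : ℝ}
    (hs : 0 ≤ s) (hst : s ≤ t) :
    ∫ y in (0 : ℝ)..(2 * Real.pi), g y * (occDensity 0 t y - occDensity 0 s y) =
      2 * Real.pi * ∫ r in s..t, g (roughPath r : RealTorus) := by
  have hq : Continuous fun y : ℝ => (y : RealTorus) := AddCircle.continuous_mk' _
  have hX := continuous_roughPath
  have h1 := continuous_occDensity 0 hs
  have h2 := continuous_occDensity 0 (hs.trans hst)
  simp only [mul_sub]
  rw [intervalIntegral.integral_sub (Continuous.intervalIntegrable (by fun_prop) _ _)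
      (Continuous.intervalIntegrable (by fun_prop) _ _),
    integral_mul_occDensity hg hs, integral_mul_occDensity hg (hs.trans hst), ← mul_sub,
    intervalIntegral.integral_interval_sub_left
      (Continuous.intervalIntegrable (by fun_prop) _ _)
      (Continuous.intervalIntegrable (by fun_prop) _ _)]

lemma eq_zero_of_integral_nonpos {h : RealTorus → ℝ} (hc : Continuous h) (h0 : ∀ x, 0 ≤ h x)
    (hi : ∫ y in (0 : ℝ)..(2 * Real.pi), h y ≤ 0) (x : RealTorus) : h x = 0 := by
  by_contra hx
  obtain ⟨y, hy, rfl⟩ : ∃ y ∈ Ico (0 : ℝ) (0 + 2 * Real.pi), (y : RealTorus) = x :=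
    ⟨_, (AddCircle.equivIco (2 * Real.pi) 0 x).2, AddCircle.coe_equivIco⟩
  rw [zero_add] at hy
  refine hi.not_gt (intervalIntegral.integral_pos Real.two_pi_pos
    (hc.comp (AddCircle.continuous_mk' _)).continuousOn (fun _ _ => h0 _)
    ⟨y, Ico_subset_Icc_self hy, lt_of_le_of_ne (h0 _) (Ne.symm hx)⟩)

lemma occDensity_mono {s t : ℝ} (hs : 0 ≤ s) (hst : s ≤ t) (x : RealTorus) :
    occDensity 0 s x ≤ occDensity 0 t x := by
  have h1 := continuous_occDensity 0 hs
  have h2 := continuous_occDensity 0 (hs.trans hst)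
  set g : RealTorus → ℝ := fun x => max (-(occDensity 0 t x - occDensity 0 s x)) 0 with hg
  have hgc : Continuous g := by fun_prop
  have hsq : ∀ x, g x * (occDensity 0 t x - occDensity 0 s x) = -(g x ^ 2) := fun x => by
    simp only [hg]
    rcases le_total (-(occDensity 0 t x - occDensity 0 s x)) 0 with h | h
    · rw [max_eq_right h]; ring
    · rw [max_eq_left h]; ring
  have hI := integral_mul_occDensity_sub hgc hs hst
  simp only [hsq, intervalIntegral.integral_neg] at hI
  have hpos : 0 ≤ ∫ r in s..t, g (roughPath r : RealTorus) :=
    intervalIntegral.integral_nonneg hst fun _ _ => le_max_right _ _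
  have hz := eq_zero_of_integral_nonpos (h := fun x => g x ^ 2) (by fun_prop)
    (fun x => sq_nonneg _) (by nlinarith [mul_nonneg Real.two_pi_pos.le hpos]) x
  have hz' : g x = 0 := by simpa using hz
  have := (le_max_left (-(occDensity 0 t x - occDensity 0 s x)) 0).trans_eq hz'
  linarith

lemma occDensity_zero_time (x : RealTorus) : occDensity 0 0 x = 0 := by
  simp [occDensity, occSeries, occTerm, occCoeff]

lemma occDensity_nonneg {t : ℝ} (ht : 0 ≤ t) (x : RealTorus) : 0 ≤ occDensity 0 t x := by
  simpa [occDensity_zero_time] using occDensity_mono le_rfl ht x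

/-- The occupation density at a point increases only when the path visits that point. -/
lemma exists_roughPath_eq_of_occDensity_lt {s t : ℝ} (hs : 0 ≤ s) (hst : s ≤ t) {x : RealTorus}
    (hx : occDensity 0 s x < occDensity 0 t x) : ∃ r ∈ Icc s t, (roughPath r : RealTorus) = x := by
  have h1 := continuous_occDensity 0 hs
  have h2 := continuous_occDensity 0 (hs.trans hst)
  have hX := continuous_roughPath
  have hq : Continuous fun y : ℝ => (y : RealTorus) := AddCircle.continuous_mk' _
  set Z : Set RealTorus := (fun r : ℝ => (roughPath r : RealTorus)) '' Icc s t with hZ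
  have hZc : IsCompact Z := isCompact_Icc.image (by fun_prop)
  have hZn : Z.Nonempty := (nonempty_Icc.2 hst).image _
  have hI := integral_mul_occDensity_sub
    (g := fun x => (occDensity 0 t x - occDensity 0 s x) * Metric.infDist x Z)
    ((h2.sub h1).mul (Metric.continuous_infDist_pt Z)) hs hst
  have hR : ∫ r in s..t, (occDensity 0 t (roughPath r) - occDensity 0 s (roughPath r)) *
      Metric.infDist (roughPath r : RealTorus) Z = 0 := by
    rw [intervalIntegral.integral_congr (g := fun _ => (0 : ℝ))]
    · simp
    · intro r hr
      rw [uIcc_of_le hst] at hr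
      simp only
      rw [Metric.infDist_zero_of_mem (show (roughPath r : RealTorus) ∈ Z from ⟨r, hr, rfl⟩), mul_zero]
  rw [hR, mul_zero] at hI
  have hz := eq_zero_of_integral_nonpos
    (h := fun x => (occDensity 0 t x - occDensity 0 s x) * Metric.infDist x Z *
      (occDensity 0 t x - occDensity 0 s x))
    (((h2.sub h1).mul (Metric.continuous_infDist_pt Z)).mul (h2.sub h1))
    (fun x => by
      have := sub_nonneg.2 (occDensity_mono hs hst x)
      have h3 := Metric.infDist_nonneg (x := x) (s := Z)
      positivity) hI.le x
  have hne := (sub_pos.2 hx).ne'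
  simp only [mul_eq_zero, hne, false_or, or_false] at hz
  exact (hZc.isClosed.mem_iff_infDist_zero hZn).2 hz

lemma integral_occDensity {t : ℝ} (ht : 0 ≤ t) :
    ∫ y in (0 : ℝ)..(2 * Real.pi), occDensity 0 t y = 2 * Real.pi * t := by
  have := integral_mul_occDensity (g := fun _ => 1) continuous_const ht
  simpa using this

lemma exists_occDensity_pos {t : ℝ} (ht : 0 < t) : ∃ x, 0 < occDensity 0 t x := by
  by_contra! h
  have h0 : ∀ x, occDensity 0 t x = 0 := fun x => le_antisymm (h x) (occDensity_nonneg ht.le x)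
  have := integral_occDensity ht.le
  simp only [h0, intervalIntegral.integral_zero] at this
  have := mul_pos Real.two_pi_pos ht
  linarith

/-- The path stays in the support of its occupation density. -/
lemma roughPath_mem_closure {r t : ℝ} (ht : 0 < t) (hr : r ∈ Icc 0 t) :
    (roughPath r : RealTorus) ∈ closure {x | 0 < occDensity 0 t x} := by
  have hX := continuous_roughPath
  have hq : Continuous fun y : ℝ => (y : RealTorus) := AddCircle.continuous_mk' _
  set Z : Set RealTorus := {x | 0 < occDensity 0 t x} with hZ
  have hI := integral_mul_occDensity (Metric.continuous_infDist_pt Z) ht.le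
  have h0 : ∀ x, Metric.infDist x Z * occDensity 0 t x = 0 := fun x => by
    rcases (occDensity_nonneg ht.le x).eq_or_lt with h | h
    · rw [← h, mul_zero]
    · rw [Metric.infDist_zero_of_mem (show x ∈ Z from h), zero_mul]
  simp only [h0, intervalIntegral.integral_zero] at hI
  have hZn : Z.Nonempty := exists_occDensity_pos ht
  refine (Metric.mem_closure_iff_infDist_zero (s := Z) (x := (roughPath r : RealTorus)) hZn).2 ?_
  by_contra hne
  have hpos := intervalIntegral.integral_pos
    (f := fun r => Metric.infDist (roughPath r : RealTorus) Z) ht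
    ((Metric.continuous_infDist_pt Z).comp (hq.comp hX)).continuousOn
    (fun _ _ => Metric.infDist_nonneg)
    ⟨r, hr, lt_of_le_of_ne Metric.infDist_nonneg (Ne.symm hne)⟩
  have := mul_pos Real.two_pi_pos hpos
  linarith

lemma occCoeff_nat_add_one (k : ℝ) (n : ℕ) :
    occCoeff k (n + 1) =
      occCoeff k n + Complex.exp (Complex.I * k * n) * occCoeff k 1 := by
  have hX := continuous_roughPath
  have hi : ∀ a b : ℝ, IntervalIntegrable (fun s : ℝ => Complex.exp (Complex.I * k * roughPath s))
      MeasureTheory.volume a b := fun a b => Continuous.intervalIntegrable (by fun_prop) _ _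
  have h : ∫ s in (n : ℝ)..(n + 1), Complex.exp (Complex.I * k * roughPath s) =
      ∫ s in (0 : ℝ)..1, Complex.exp (Complex.I * k * roughPath (s + n)) := by
    rw [intervalIntegral.integral_comp_add_right
      (fun s => Complex.exp (Complex.I * k * roughPath s)) (n : ℝ), zero_add, add_comm (1 : ℝ)]
  rw [occCoeff, ← intervalIntegral.integral_add_adjacent_intervals (hi 0 n) (hi n (n + 1)), h,
    occCoeff, occCoeff, ← intervalIntegral.integral_const_mul]
  congr 1
  refine intervalIntegral.integral_congr fun s _ => ?_
  rw [← Complex.exp_add, roughPath_add_nat]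
  congr 1
  push_cast
  ring

lemma occDensity_nat_add_one (n : ℕ) (x : RealTorus) :
    occDensity 0 (n + 1) x =
      occDensity 0 n x + occDensity 0 1 (x - ((n : ℝ) : RealTorus)) := by
  have h : ∀ k : ℤ, occTerm 0 k (n + 1) x =
      occTerm 0 k n x + occTerm 0 k 1 (x - ((n : ℝ) : RealTorus)) := fun k => by
    induction x using QuotientAddGroup.induction_on with
    | H y =>
      have h1 : fourier k ((y : RealTorus) - ((n : ℝ) : RealTorus)) =
          Complex.exp (Complex.I * ((-k : ℝ) : ℂ) * n) * fourier k (y : RealTorus) := by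
        rw [← AddCircle.coe_sub, fourier_coe_realTorus, fourier_coe_realTorus, ← Complex.exp_add]
        congr 1
        push_cast
        ring
      change occCoeff _ _ * _ * fourier k (y : RealTorus) =
        occCoeff _ _ * _ * fourier k (y : RealTorus) +
        occCoeff _ _ * _ * fourier k ((y : RealTorus) - ((n : ℝ) : RealTorus))
      rw [occCoeff_nat_add_one, h1]
      ring
  simp only [occDensity, occSeries, h]
  rw [(summable_occTerm 0 n.cast_nonneg x).tsum_add (summable_occTerm 0 zero_le_one _),
    Complex.add_re]

lemma denseRange_nat_realTorus : DenseRange fun n : ℕ => ((n : ℝ) : RealTorus) := by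
  have h : DenseRange ((· • ((1 : ℝ) : RealTorus)) : ℤ → RealTorus) := by
    rw [AddCircle.denseRange_zsmul_coe_iff]
    have := (irrational_pi.natCast_mul (m := 2) (by norm_num)).inv
    simpa using this
  rw [denseRange_zsmul_iff_nsmul] at h
  convert h using 2 with n
  rw [← AddCircle.coe_nsmul]
  simp

lemma exists_forall_occDensity_pos : ∃ N : ℕ, ∀ x, 0 < occDensity 0 N x := by
  have hc := continuous_occDensity 0 zero_le_one
  have hpt : ∀ x : RealTorus, ∃ n : ℕ, 0 < occDensity 0 n x := fun x => by
    obtain ⟨z, hz⟩ := exists_occDensity_pos zero_lt_one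
    obtain ⟨n, hn⟩ := denseRange_nat_realTorus.exists_mem_open
      (s := (fun z => x - z) ⁻¹' {z | 0 < occDensity 0 1 z})
      ((isOpen_lt continuous_const hc).preimage (by fun_prop)) ⟨x - z, by simpa using hz⟩
    refine ⟨n + 1, ?_⟩
    push_cast
    rw [occDensity_nat_add_one]
    exact add_pos_of_nonneg_of_pos (occDensity_nonneg n.cast_nonneg x) hn
  obtain ⟨N, hN⟩ := isCompact_univ.elim_directed_cover
    (fun n : ℕ => {x : RealTorus | 0 < occDensity 0 n x})
    (fun n => isOpen_lt continuous_const (continuous_occDensity 0 n.cast_nonneg))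
    (fun x _ => mem_iUnion.2 (hpt x))
    (directed_of_isDirected_le fun m n hmn x hx =>
      lt_of_lt_of_le hx (occDensity_mono m.cast_nonneg (Nat.cast_le.2 hmn) x))
  exact ⟨N, fun x => hN (mem_univ x)⟩

lemma exists_endTime : ∃ T : ℝ, 0 < T ∧ (∀ x, 0 < occDensity 0 T x) ∧
    (roughPath T : RealTorus) = (Real.pi : RealTorus) := by
  obtain ⟨N, hN⟩ := exists_forall_occDensity_pos
  have hpi := Real.two_le_pi
  obtain ⟨M, hM⟩ := exists_nat_ge (Real.pi + N * (2 * Real.pi))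
  have h1 : (N : ℝ) ≤ Real.pi + N * (2 * Real.pi) := by nlinarith [(Nat.cast_nonneg N : (0 : ℝ) ≤ N)]
  obtain ⟨T, hT, hTX⟩ := intermediate_value_Icc (h1.trans hM) continuous_roughPath.continuousOn
    (show Real.pi + N * (2 * Real.pi) ∈ Icc (roughPath N) (roughPath M) by
      rw [roughPath_nat, roughPath_nat]; exact ⟨h1, hM⟩)
  have hT0 : 0 ≤ T := N.cast_nonneg.trans hT.1
  have hpos : ∀ x, 0 < occDensity 0 T x := fun x =>
    (hN x).trans_le (occDensity_mono N.cast_nonneg hT.1 x)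
  refine ⟨T, hT0.lt_of_ne ?_, hpos, ?_⟩
  · rintro rfl
    simpa [occDensity_zero_time] using hpos 0
  · rw [hTX, AddCircle.coe_add, add_eq_left, AddCircle.coe_eq_zero_iff]
    exact ⟨N, by simp⟩

/-- The increasing family of functions whose normalised graphs are swept out by the path. -/
noncomputable def fillFun (c d T τ : ℝ) (x : RealTorus) : ℝ :=
  c + (d - c) * (occDensity 0 τ x / occDensity 0 T x)

/-- The space derivative of `fillFun`. -/
noncomputable def fillDeriv (c d T τ : ℝ) (x : RealTorus) : ℝ :=
  (d - c) * ((occDensity 1 τ x * occDensity 0 T x - occDensity 0 τ x * occDensity 1 T x) /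
    occDensity 0 T x ^ 2)

section
variable {c d T : ℝ}

lemma fillFun_zero (x : RealTorus) : fillFun c d T 0 x = c := by
  simp [fillFun, occDensity_zero_time]

lemma fillFun_end (hpos : ∀ x, 0 < occDensity 0 T x) (x : RealTorus) : fillFun c d T T x = d := by
  rw [fillFun, div_self (hpos x).ne']
  ring

lemma fillFun_mono (hcd : c < d) (hpos : ∀ x, 0 < occDensity 0 T x) {s t : ℝ} (hs : 0 ≤ s)
    (hst : s ≤ t) (x : RealTorus) : fillFun c d T s x ≤ fillFun c d T t x := by
  have h1 := occDensity_mono hs hst x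
  have h2 := sub_pos.2 hcd
  have h3 := hpos x
  unfold fillFun
  gcongr

lemma fillFun_mem_Icc (hcd : c < d) (hpos : ∀ x, 0 < occDensity 0 T x) {t : ℝ}
    (ht : t ∈ Icc 0 T) (x : RealTorus) : fillFun c d T t x ∈ Icc c d :=
  ⟨by simpa only [fillFun_zero] using fillFun_mono hcd hpos le_rfl ht.1 x,
    by simpa only [fillFun_end hpos] using fillFun_mono hcd hpos ht.1 ht.2 x⟩

lemma lt_fillFun_iff (hcd : c < d) (hpos : ∀ x, 0 < occDensity 0 T x) (t : ℝ) (x : RealTorus) :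
    c < fillFun c d T t x ↔ 0 < occDensity 0 t x := by
  rw [fillFun, lt_add_iff_pos_right, mul_pos_iff_of_pos_left (sub_pos.2 hcd),
    div_pos_iff_of_pos_right (hpos x)]

lemma occDensity_lt_of_fillFun_lt (hcd : c < d) (hpos : ∀ x, 0 < occDensity 0 T x) {s t : ℝ}
    {x : RealTorus} (h : fillFun c d T s x < fillFun c d T t x) :
    occDensity 0 s x < occDensity 0 t x := by
  rwa [fillFun, fillFun, add_lt_add_iff_left, mul_lt_mul_iff_right₀ (sub_pos.2 hcd),
    div_lt_div_iff_of_pos_right (hpos x)] at h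

lemma continuousOn_fillFun (hT : 0 < T) (hpos : ∀ x, 0 < occDensity 0 T x) :
    ContinuousOn (fun p : ℝ × RealTorus => fillFun c d T p.1 p.2) (Icc 0 T ×ˢ univ) := by
  have h := (continuous_occDensity 0 hT.le).comp (continuous_snd (X := ℝ))
  exact continuousOn_const.add (continuousOn_const.mul
    ((continuousOn_occDensity 0 T).div h.continuousOn fun p _ => (hpos p.2).ne'))

lemma continuousOn_fillDeriv (hT : 0 < T) (hpos : ∀ x, 0 < occDensity 0 T x) :
    ContinuousOn (fun p : ℝ × RealTorus => fillDeriv c d T p.1 p.2) (Icc 0 T ×ˢ univ) := by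
  have h0 := ((continuous_occDensity 0 hT.le).comp (continuous_snd (X := ℝ))).continuousOn
    (s := Icc 0 T ×ˢ univ)
  have h1 := ((continuous_occDensity 1 hT.le).comp (continuous_snd (X := ℝ))).continuousOn
    (s := Icc 0 T ×ˢ univ)
  exact continuousOn_const.mul ((((continuousOn_occDensity 1 T).mul h0).sub
    ((continuousOn_occDensity 0 T).mul h1)).div (h0.pow 2) fun p _ => (pow_pos (hpos p.2) 2).ne')

lemma continuous_fillFun (hT : 0 < T) (hpos : ∀ x, 0 < occDensity 0 T x) {t : ℝ}
    (ht : t ∈ Icc 0 T) : Continuous (fillFun c d T t) := by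
  rw [← continuousOn_univ]
  exact (continuousOn_fillFun hT hpos).comp (f := fun x : RealTorus => (t, x)) (by fun_prop)
    fun x _ => ⟨ht, mem_univ _⟩

lemma continuousOn_fillFun_time (hT : 0 < T) (hpos : ∀ x, 0 < occDensity 0 T x) (x : RealTorus) :
    ContinuousOn (fun t => fillFun c d T t x) (Icc 0 T) :=
  (continuousOn_fillFun hT hpos).comp (f := fun t : ℝ => (t, x)) (by fun_prop)
    fun t ht => ⟨ht, mem_univ _⟩

lemma hasDerivAt_fillFun (hT : 0 < T) (hpos : ∀ x, 0 < occDensity 0 T x) {t : ℝ} (ht : 0 ≤ t)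
    (y : ℝ) : HasDerivAt (fun y : ℝ => fillFun c d T t (y : RealTorus)) (fillDeriv c d T t y) y :=
  (((hasDerivAt_occDensity 0 ht y).div (hasDerivAt_occDensity 0 hT.le y)
    (hpos y).ne').const_mul (d - c)).const_add c

lemma contDiff_fillFun (hT : 0 < T) (hpos : ∀ x, 0 < occDensity 0 T x) {t : ℝ} (ht : 0 ≤ t) :
    ContDiff ℝ (⊤ : ℕ∞) (fun y : ℝ => fillFun c d T t (y : RealTorus)) :=
  contDiff_const.add (contDiff_const.mul ((contDiff_occDensity ht).div (contDiff_occDensity hT.le)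
    fun y => (hpos y).ne'))

lemma exists_fillFun_eq (hT : 0 < T) (hpos : ∀ x, 0 < occDensity 0 T x) {y : ℝ}
    (hy : y ∈ Icc c d) (x : RealTorus) : ∃ t ∈ Icc 0 T, fillFun c d T t x = y :=
  intermediate_value_Icc hT.le (continuousOn_fillFun_time hT hpos x)
    (by rwa [fillFun_zero, fillFun_end hpos])

lemma fillDeriv_eq_of_fillFun_eq (hcd : c < d) (hT : 0 < T) (hpos : ∀ x, 0 < occDensity 0 T x)
    {s t : ℝ} (hs : 0 ≤ s) (hst : s ≤ t) {x : RealTorus}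
    (h : fillFun c d T s x = fillFun c d T t x) : fillDeriv c d T s x = fillDeriv c d T t x := by
  induction x using QuotientAddGroup.induction_on with
  | H y =>
    have hd := (hasDerivAt_fillFun (c := c) (d := d) hT hpos (hs.trans hst) y).sub
      (hasDerivAt_fillFun (c := c) (d := d) hT hpos hs y)
    have hmin : IsLocalMin ((fun y : ℝ => fillFun c d T t (y : RealTorus)) -
        fun y : ℝ => fillFun c d T s (y : RealTorus)) y := by
      refine .of_forall fun z => ?_
      have h1 := fillFun_mono hcd hpos hs hst (z : RealTorus)
      have h2 : fillFun c d T t (y : RealTorus) - fillFun c d T s (y : RealTorus) = 0 :=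
        sub_eq_zero.2 h.symm
      simp only [Pi.sub_apply, h2]
      linarith
    exact (sub_eq_zero.1 (hmin.hasDerivAt_eq_zero hd)).symm

/-- The slopes of the members of the family depend continuously on the point of the graph. -/
lemma exists_slopeField (hcd : c < d) (hT : 0 < T) (hpos : ∀ x, 0 < occDensity 0 T x) :
    ∃ ψ : RealTorus × ℝ → ℝ, ContinuousOn ψ (univ ×ˢ Icc c d) ∧
      ∀ t ∈ Icc 0 T, ∀ x, ψ (x, fillFun c d T t x) = fillDeriv c d T t x := by
  have hex : ∀ p : RealTorus × ℝ, ∃ t, p.2 ∈ Icc c d → t ∈ Icc 0 T ∧ fillFun c d T t p.1 = p.2 :=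
    fun p => by
      by_cases hp : p.2 ∈ Icc c d
      · obtain ⟨t, ht⟩ := exists_fillFun_eq hT hpos hp p.1
        exact ⟨t, fun _ => ht⟩
      · exact ⟨0, fun h => absurd h hp⟩
  choose θ hθ using hex
  have hψ : ∀ t ∈ Icc 0 T, ∀ x, fillDeriv c d T (θ (x, fillFun c d T t x)) x =
      fillDeriv c d T t x := fun t ht x => by
    obtain ⟨h1, h2⟩ := hθ (x, fillFun c d T t x) (fillFun_mem_Icc hcd hpos ht x)
    rcases le_total (θ (x, fillFun c d T t x)) t with h | h
    · exact fillDeriv_eq_of_fillFun_eq hcd hT hpos h1.1 h h2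
    · exact (fillDeriv_eq_of_fillFun_eq hcd hT hpos ht.1 h h2.symm).symm
  refine ⟨fun p => fillDeriv c d T (θ p) p.1, ?_, hψ⟩
  rw [continuousOn_iff_continuous_domRestrict]
  let q : (Icc 0 T ×ˢ univ : Set (ℝ × RealTorus)) → (univ ×ˢ Icc c d : Set (RealTorus × ℝ)) :=
    fun p => ⟨(p.1.2, fillFun c d T p.1.1 p.1.2), mem_univ _, fillFun_mem_Icc hcd hpos p.2.1 _⟩
  have hq : Continuous q :=
    ((continuous_snd.comp continuous_subtype_val).prodMk
      (continuousOn_iff_continuous_domRestrict.1 (continuousOn_fillFun hT hpos))).subtype_mk _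
  have hqs : Function.Surjective q := by
    rintro ⟨⟨x, y⟩, hxy⟩
    obtain ⟨t, ht, hy⟩ := exists_fillFun_eq hT hpos hxy.2 x
    exact ⟨⟨(t, x), ht, mem_univ _⟩, Subtype.ext (Prod.ext rfl hy)⟩
  have : CompactSpace (Icc 0 T ×ˢ univ : Set (ℝ × RealTorus)) :=
    isCompact_iff_compactSpace.1 (isCompact_Icc.prod isCompact_univ)
  rw [(hq.isClosedMap.isQuotientMap hq hqs).continuous_iff]
  refine (continuousOn_iff_continuous_domRestrict.1
    (continuousOn_fillDeriv (c := c) (d := d) hT hpos)).congr fun p => ?_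
  exact (hψ p.1.1 p.2.1 p.1.2).symm

end

lemma Function.Periodic.iteratedDeriv {h : ℝ → ℝ} {a : ℝ} (hp : Function.Periodic h a) (m : ℕ) :
    Function.Periodic (iteratedDeriv m h) a := by
  intro x
  have := congrFun (iteratedDeriv_comp_add_const m h a) x
  rw [← this, hp.funext]

lemma exists_abs_iteratedDeriv_le {h : ℝ → ℝ} {a : ℝ} (hp : Function.Periodic h a) (ha : a ≠ 0)
    (hc : ContDiff ℝ (⊤ : ℕ∞) h) (m : ℕ) : ∃ C, ∀ x, |iteratedDeriv m h x| ≤ C := by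
  obtain ⟨C, hC⟩ := isBounded_iff_forall_norm_le.1
    ((hp.iteratedDeriv m).isBounded_of_continuous ha
      (hc.continuous_iteratedDeriv m (by exact_mod_cast le_top)))
  exact ⟨C, fun x => hC _ ⟨x, rfl⟩⟩

lemma eventually_abs_iteratedDeriv_fillFun_sub_lt {c d T : ℝ} (hT : 0 < T)
    (hpos : ∀ x, 0 < occDensity 0 T x) {t : ℝ} (ht : t ∈ Icc 0 T) (i : ℕ) {ε : ℝ} (hε : 0 < ε) :
    ∀ᶠ s in nhdsWithin t (Icc 0 T), ∀ x : ℝ, |iteratedDeriv i (fun y : ℝ =>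
      fillFun c d T s (y : RealTorus) - fillFun c d T t (y : RealTorus)) x| < ε := by
  set h : ℝ → ℝ := fun y => (d - c) / occDensity 0 T (y : RealTorus) with hh
  have hc : ContDiff ℝ (⊤ : ℕ∞) h :=
    contDiff_const.div (contDiff_occDensity hT.le) fun y => (hpos y).ne'
  have hp : Function.Periodic h (2 * Real.pi) := fun y => by
    simp only [hh, AddCircle.coe_add_period]
  choose C hC using exists_abs_iteratedDeriv_le hp Real.two_pi_pos.ne' hc
  set M : ℝ := ∑ j ∈ Finset.range (i + 1), i.choose j * C (i - j) with hM
  have hC0 : ∀ m, 0 ≤ C m := fun m => (abs_nonneg _).trans (hC m 0)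
  have hM0 : 0 ≤ M := Finset.sum_nonneg fun j _ => mul_nonneg (Nat.cast_nonneg _) (hC0 _)
  have hη : 0 < ε / (M + 1) := by positivity
  have hev : ∀ᶠ s in nhdsWithin t (Icc 0 T), ∀ j ∈ Finset.range (i + 1), ∀ x : RealTorus,
      |occDensity j s x - occDensity j t x| < ε / (M + 1) := by
    rw [Filter.eventually_all_finset]
    intro j _
    obtain ⟨δ, hδ, H⟩ := exists_abs_occDensity_sub_lt T j hη
    filter_upwards [self_mem_nhdsWithin, nhdsWithin_le_nhds (Metric.ball_mem_nhds t hδ)]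
      with s hs hst x using H t ht s hs hst x
  filter_upwards [hev, self_mem_nhdsWithin] with s hs hsT x
  have hfun : (fun y : ℝ => fillFun c d T s (y : RealTorus) - fillFun c d T t (y : RealTorus)) =
      fun y : ℝ => (occDensity 0 s (y : RealTorus) - occDensity 0 t (y : RealTorus)) * h y := by
    funext y
    simp only [fillFun, hh]
    ring
  have hcs := contDiff_occDensity hsT.1
  have hct := contDiff_occDensity ht.1
  have hi : ((i : ℕ∞) : WithTop ℕ∞) ≤ ((⊤ : ℕ∞) : WithTop ℕ∞) := by exact_mod_cast le_top
  rw [hfun, iteratedDeriv_fun_mul ((hcs.sub hct).of_le hi).contDiffAt (hc.of_le hi).contDiffAt]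
  have hterm : ∀ j ∈ Finset.range (i + 1), |i.choose j * iteratedDeriv j (fun y : ℝ =>
      occDensity 0 s (y : RealTorus) - occDensity 0 t (y : RealTorus)) x *
      iteratedDeriv (i - j) h x| ≤ i.choose j * C (i - j) * (ε / (M + 1)) := by
    intro j hj
    have hj' : ((j : ℕ∞) : WithTop ℕ∞) ≤ ((⊤ : ℕ∞) : WithTop ℕ∞) := by exact_mod_cast le_top
    rw [iteratedDeriv_fun_sub (hcs.of_le hj').contDiffAt (hct.of_le hj').contDiffAt,
      iteratedDeriv_occDensity j hsT.1, iteratedDeriv_occDensity j ht.1, abs_mul, abs_mul,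
      Nat.abs_cast, mul_assoc, mul_assoc, mul_comm (C _)]
    exact mul_le_mul_of_nonneg_left (mul_le_mul (hs j hj _).le (hC _ _) (abs_nonneg _) hη.le)
      (Nat.cast_nonneg _)
  calc _ ≤ ∑ j ∈ Finset.range (i + 1), i.choose j * C (i - j) * (ε / (M + 1)) :=
        (Finset.abs_sum_le_sum_abs _ _).trans (Finset.sum_le_sum hterm)
    _ = M * (ε / (M + 1)) := by rw [← Finset.sum_mul]
    _ < (M + 1) * (ε / (M + 1)) := by nlinarith
    _ = ε := by field_simp

/-- The closed region under the graph of a member of the family is swept out by the path. -/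
lemma image_fill_eq_closure {c d T : ℝ} (hcd : c < d) (hT : 0 < T)
    (hpos : ∀ x, 0 < occDensity 0 T x) {t : ℝ} (ht : t ∈ Ioc 0 T) :
    (fun r : ℝ => ((roughPath r : RealTorus), fillFun c d T r (roughPath r))) '' Icc 0 t =
      closure (interior {p : RealTorus × ℝ | c ≤ p.2 ∧ p.2 ≤ fillFun c d T t p.1}) := by
  have hX := continuous_roughPath
  have hq : Continuous fun y : ℝ => (y : RealTorus) := AddCircle.continuous_mk' _
  have hqX : Continuous fun r : ℝ => (roughPath r : RealTorus) := hq.comp hX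
  have htT : t ∈ Icc 0 T := Ioc_subset_Icc_self ht
  have hsub : Icc 0 t ⊆ Icc 0 T := Icc_subset_Icc_right ht.2
  have hFt : Continuous (fillFun c d T t) := continuous_fillFun hT hpos htT
  have hint : interior {p : RealTorus × ℝ | c ≤ p.2 ∧ p.2 ≤ fillFun c d T t p.1} =
      {p : RealTorus × ℝ | c < p.2 ∧ p.2 < fillFun c d T t p.1} := by
    refine Subset.antisymm (fun p hp => ?_) (interior_maximal (fun p hp => ⟨hp.1.le, hp.2.le⟩) ?_)
    · have hline : Continuous fun e : ℝ => (p.1, p.2 + e) := by fun_prop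
      have h0 : ∀ᶠ e in nhds (0 : ℝ), (p.1, p.2 + e) ∈
          {p : RealTorus × ℝ | c ≤ p.2 ∧ p.2 ≤ fillFun c d T t p.1} :=
        hline.continuousAt.eventually (by
          beta_reduce
          rw [add_zero]
          exact mem_interior_iff_mem_nhds.1 hp)
      obtain ⟨ε, hε, H⟩ := Metric.eventually_nhds_iff.1 h0
      have h1 := (H (y := ε / 2) (by simp [abs_of_pos hε, hε])).2
      have h2 := (H (y := -(ε / 2)) (by simp [abs_of_pos hε, hε])).1
      simp only at h1 h2
      exact ⟨by linarith, by linarith⟩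
    · exact (isOpen_lt continuous_const continuous_snd).inter
        (isOpen_lt continuous_snd (hFt.comp continuous_fst))
  have hγ : ContinuousOn
      (fun r : ℝ => ((roughPath r : RealTorus), fillFun c d T r (roughPath r))) (Icc 0 T) :=
    hqX.continuousOn.prodMk ((continuousOn_fillFun hT hpos).comp
      (f := fun r : ℝ => (r, (roughPath r : RealTorus)))
      (continuous_id.prodMk hqX).continuousOn fun r hr => ⟨hr, mem_univ _⟩)
  rw [hint]
  refine Subset.antisymm ?_ (closure_minimal ?_
    (isCompact_Icc.image_of_continuousOn (hγ.mono hsub)).isClosed)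
  · rintro _ ⟨r, hr, rfl⟩
    set x : RealTorus := (roughPath r : RealTorus) with hx
    have hxc : x ∈ closure {x | 0 < occDensity 0 t x} := roughPath_mem_closure ht.1 hr
    have h1 := (fillFun_mem_Icc hcd hpos (hsub hr) x).1
    have h2 := fillFun_mono hcd hpos hr.1 hr.2 x
    obtain ⟨θ, hθ, hy⟩ : ∃ θ ∈ Icc (0 : ℝ) 1,
        c + θ * (fillFun c d T t x - c) = fillFun c d T r x := by
      refine intermediate_value_Icc zero_le_one
        (f := fun θ => c + θ * (fillFun c d T t x - c)) (by fun_prop) ⟨by simpa, by simpa⟩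
    change (x, fillFun c d T r x) ∈ _
    rw [← hy]
    rw [← closure_Ioo zero_ne_one] at hθ
    refine map_mem_closure₂ (f := fun (x : RealTorus) (θ : ℝ) =>
      (x, c + θ * (fillFun c d T t x - c))) ?_ hxc hθ ?_
    · simp only [Function.uncurry_def]
      fun_prop
    · intro z hz θ hθ
      have hz' := sub_pos.2 ((lt_fillFun_iff hcd hpos t z).2 hz)
      have h3 := mul_pos hθ.1 hz'
      have h4 := mul_lt_of_lt_one_left hz' hθ.2
      exact ⟨by simpa using h3, by simp only; linarith⟩
  · rintro ⟨x, y⟩ ⟨hcy, hyF⟩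
    simp only at hcy hyF
    have hFx : ContinuousOn (fun s => fillFun c d T s x) (Icc 0 t) :=
      (continuousOn_fillFun_time hT hpos x).mono hsub
    have hK : IsCompact (Icc 0 t ∩ (fun s => fillFun c d T s x) ⁻¹' Iic y) :=
      isCompact_Icc.of_isClosed_subset (hFx.preimage_isClosed_of_isClosed isClosed_Icc isClosed_Iic)
        inter_subset_left
    obtain ⟨b, ⟨hb, hby⟩, hmax⟩ := hK.exists_isGreatest
      ⟨0, left_mem_Icc.2 ht.1.le, by simpa [fillFun_zero] using hcy.le⟩
    simp only [mem_preimage, mem_Iic] at hby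
    have hbt : b < t := hb.2.lt_of_ne (by rintro rfl; exact hby.not_gt hyF)
    have hgt : ∀ s ∈ Ioc b t, y < fillFun c d T s x := fun s hs => by
      by_contra! h
      exact (hmax ⟨⟨hb.1.trans hs.1.le, hs.2⟩, h⟩).not_gt hs.1
    have hyb : fillFun c d T b x = y := by
      obtain ⟨s, hs, hsy⟩ := intermediate_value_Icc hb.2 (hFx.mono (Icc_subset_Icc_left hb.1))
        ⟨hby, hyF.le⟩
      rcases hs.1.eq_or_lt with rfl | h
      · exact hsy
      · exact absurd hsy (hgt s ⟨h, hs.2⟩).ne'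
    have hxb : (roughPath b : RealTorus) = x := by
      by_contra hne
      obtain ⟨ε, hε, H⟩ := Metric.eventually_nhds_iff.1
        (hqX.continuousAt.eventually_ne (x := b) hne)
      have hbe : b < min t (b + ε / 2) := lt_min hbt (by linarith)
      have hlt := occDensity_lt_of_fillFun_lt (c := c) (d := d) hcd hpos
        (hyb.trans_lt (hgt _ ⟨hbe, min_le_left _ _⟩))
      obtain ⟨r, hr, hrx⟩ := exists_roughPath_eq_of_occDensity_lt hb.1 hbe.le hlt
      refine H ?_ hrx
      have := hr.2.trans (min_le_right _ _)
      rw [Real.dist_eq, abs_of_nonneg (by linarith [hr.1])]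
      linarith
    refine ⟨b, hb, ?_⟩
    simp only [hxb, hyb]

/-- **Cylindrical version.** Given intervals `[t₀,t₁]` and `[c,d]`, there
exist a continuous `γ : [t₀,t₁] → 𝕋 × [c,d]`, a family `t ↦ F_t ∈ C^∞(𝕋)` continuous into
the `C^∞` topology (functions on `𝕋` are identified with `2π`-periodic functions on `ℝ`),
and a continuous `ψ : 𝕋 × [c,d] → ℝ`, such that:
(i)   `F_{t₀} ≡ c` and `F_{t₁} ≡ d`;
(ii)  if `t ≤ s` then `F_t ≤ F_s` pointwise;
(iii) writing `γ(t) = (x(t), y(t))`, one has `y(t) = F_t(x(t))`;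
(iv)  `F_t′(x) = ψ(x, F_t(x))` for all `t` and `x ∈ 𝕋`;
(v)   for each `t ∈ (t₀,t₁]`, the footprint `γ([t₀,t])` equals the closure of the
      interior (in `𝕋 × ℝ`) of `{(x,y) : x ∈ 𝕋, c ≤ y ≤ F_t(x)}`;
(vi)  `γ(t₀) = (0, c)` and `γ(t₁) = (π, d)`. -/
theorem exists_peano_curve_filling_cylinder (t₀ t₁ c d : ℝ)
    (ht : t₀ < t₁) (hcd : c < d) :
    ∃ (γ : ℝ → RealTorus × ℝ) (F : ℝ → RealTorus → ℝ) (ψ : RealTorus × ℝ → ℝ),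
      ContinuousOn γ (Icc t₀ t₁) ∧
      (∀ t ∈ Icc t₀ t₁, (γ t).2 ∈ Icc c d) ∧
      (∀ t ∈ Icc t₀ t₁, ContDiff ℝ (⊤ : ℕ∞) (fun x : ℝ => F t (x : RealTorus))) ∧
      (∀ (k : ℕ), ∀ t ∈ Icc t₀ t₁, ∀ ε > (0:ℝ), ∃ δ > (0:ℝ),
        ∀ s ∈ Icc t₀ t₁, |s - t| < δ → ∀ i ≤ k, ∀ x : ℝ,
          |iteratedDeriv i
            (fun y : ℝ => F s (y : RealTorus) - F t (y : RealTorus)) x| < ε) ∧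
      ContinuousOn ψ (univ ×ˢ Icc c d) ∧
      (∀ x : RealTorus, F t₀ x = c) ∧ (∀ x : RealTorus, F t₁ x = d) ∧
      (∀ t ∈ Icc t₀ t₁, ∀ s ∈ Icc t₀ t₁, t ≤ s → ∀ x : RealTorus, F t x ≤ F s x) ∧
      (∀ t ∈ Icc t₀ t₁, (γ t).2 = F t (γ t).1) ∧
      (∀ t ∈ Icc t₀ t₁, ∀ x : ℝ,
        deriv (fun y : ℝ => F t (y : RealTorus)) x = ψ ((x : RealTorus), F t (x : RealTorus))) ∧
      (∀ t ∈ Ioc t₀ t₁, γ '' Icc t₀ t =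
        closure (interior {p : RealTorus × ℝ | c ≤ p.2 ∧ p.2 ≤ F t p.1})) ∧
      γ t₀ = (((0 : ℝ) : RealTorus), c) ∧ γ t₁ = ((Real.pi : RealTorus), d) := by
  obtain ⟨T, hT, hpos, hend⟩ := exists_endTime
  obtain ⟨ψ, hψ, hψF⟩ := exists_slopeField hcd hT hpos
  have hL : 0 < t₁ - t₀ := sub_pos.2 ht
  set τ : ℝ → ℝ := fun t => (t - t₀) * (T / (t₁ - t₀)) with hτ
  have hk : 0 < T / (t₁ - t₀) := div_pos hT hL
  have hτc : Continuous τ := by fun_prop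
  have hτ0 : τ t₀ = 0 := by simp [hτ]
  have hτ1 : τ t₁ = T := mul_div_cancel₀ T hL.ne'
  have hτm : StrictMono τ := fun s t hst => by
    simp only [hτ]
    gcongr
  have hτI : ∀ t, t₀ ≤ t → τ '' Icc t₀ t = Icc 0 (τ t) := fun t h => by
    refine Subset.antisymm ?_ ?_
    · rintro _ ⟨s, hs, rfl⟩
      exact ⟨hτ0.symm.trans_le (hτm.monotone hs.1), hτm.monotone hs.2⟩
    · simpa only [hτ0] using intermediate_value_Icc h hτc.continuousOn
  have hτT : MapsTo τ (Icc t₀ t₁) (Icc 0 T) := by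
    rw [mapsTo_iff_image_subset, hτI t₁ ht.le, hτ1]
  have hqX : Continuous fun r : ℝ => (roughPath r : RealTorus) :=
    (AddCircle.continuous_mk' (2 * Real.pi)).comp continuous_roughPath
  refine ⟨fun t => ((roughPath (τ t) : RealTorus), fillFun c d T (τ t) (roughPath (τ t))),
    fun t => fillFun c d T (τ t), ψ, ?_, fun t h => fillFun_mem_Icc hcd hpos (hτT h) _,
    fun t h => contDiff_fillFun hT hpos (hτT h).1, fun k t h ε hε => ?_, hψ,
    fun x => ?_, fun x => ?_, fun t h s _ hts x => fillFun_mono hcd hpos (hτT h).1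
      (hτm.monotone hts) x, fun _ _ => rfl, fun t h x => ?_, fun t h => ?_, ?_, ?_⟩
  · exact (hqX.comp hτc).continuousOn.prodMk ((continuousOn_fillFun hT hpos).comp
      (f := fun t : ℝ => (τ t, (roughPath (τ t) : RealTorus)))
      (hτc.prodMk (hqX.comp hτc)).continuousOn fun t h => ⟨hτT h, mem_univ _⟩)
  · have hev : ∀ᶠ s in nhdsWithin (τ t) (Icc 0 T), ∀ i ∈ Finset.range (k + 1), ∀ x : ℝ,
        |iteratedDeriv i (fun y : ℝ =>
          fillFun c d T s (y : RealTorus) - fillFun c d T (τ t) (y : RealTorus)) x| < ε := by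
      rw [Filter.eventually_all_finset]
      exact fun i _ => eventually_abs_iteratedDeriv_fillFun_sub_lt hT hpos (hτT h) i hε
    have hev' := (hτc.continuousWithinAt.tendsto_nhdsWithin hτT).eventually hev
    obtain ⟨δ, hδ, H⟩ := Metric.eventually_nhds_iff.1 (eventually_nhdsWithin_iff.1 hev')
    exact ⟨δ, hδ, fun s hs hst i hi x => H hst hs i (Finset.mem_range_succ_iff.2 hi) x⟩
  · simp only [hτ0, fillFun_zero]
  · simp only [hτ1, fillFun_end hpos]
  · rw [hψF _ (hτT h)]
    exact (hasDerivAt_fillFun hT hpos (hτT h).1 x).deriv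
  · have hτt : τ t ∈ Ioc 0 T :=
      ⟨hτ0.symm.trans_lt (hτm h.1), (hτT (Ioc_subset_Icc_self h)).2⟩
    rw [← image_fill_eq_closure hcd hT hpos hτt, ← hτI t h.1.le, image_image]
  · simp only [hτ0, roughPath_zero, fillFun_zero]
  · simp only [hτ1, hend, fillFun_end hpos]
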